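/- Let 𝔤 be a finite-dimensional real nilpotent Lie algebra with γ_{s+1}(𝔤) = 0 for some s ≥ 1, equipped with a norm ‖·‖ and with fixed linear subspaces A_1, …, A_s such that γ_i(𝔤) = A_i ⊕ γ_{i+1}(𝔤) for every 1 ≤ i ≤ s. Then there exists C ≥ 1 such that for every q ≥ 1, all indices i_1, …, i_q ≥ 1 and all elements u_ℓ ∈ A_{i_ℓ} (with the convention A_i = {0} for i > s), the iterated bracket satisfies |[u_1,[u_2,[…,u_q]…]]|^{i_1 + ⋯ + i_q} ≤ C·|u_1|^{i_1}⋯|u_q|^{i_q}, where |·| denotes the Guivarc'h gauge. -/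

import Mathlib

open scoped BigOperators

/-- The Guivarc'h gauge `|x| := 1 + Σ_{i=1}^{s} ‖x_i‖^{1/i}`, where `x = Σ_i x_i` with
`x_i = π i x` the component of `x` in the subspace `A_i`, and `N` is the chosen norm. -/
noncomputable def guivarchGauge {L : Type*} [LieRing L] [LieAlgebra ℝ L]
    (N : L → ℝ) (π : ℕ → L →ₗ[ℝ] L) (s : ℕ) (x : L) : ℝ :=
  1 + ∑ i ∈ Finset.Icc 1 s, (N (π i x)) ^ ((1 : ℝ) / (i : ℝ))

/-- The iterated bracket `[u_1, …, u_q] = [u_1,[u_2,[…,[u_{q-1},u_q]…]]]`, with `[u] = u`. -/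
def iterBracket {L : Type*} [LieRing L] : List L → L
  | [] => 0
  | [x] => x
  | x :: y :: tl => ⁅x, iterBracket (y :: tl)⁆

/-- `[γ_{a+1}(L), γ_{b+1}(M)] ⊆ γ_{a+b+2}(M)`, with zero-based indexing of the series. -/
theorem LieModule.lie_mem_lowerCentralSeries_add {R L M : Type*} [CommRing R] [LieRing L]
    [LieAlgebra R L] [AddCommGroup M] [Module R M] [LieRingModule L M] [LieModule R L M]
    (a b : ℕ) {x : L} {m : M} (hx : x ∈ LieModule.lowerCentralSeries R L L a)
    (hm : m ∈ LieModule.lowerCentralSeries R L M b) :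
    ⁅x, m⁆ ∈ LieModule.lowerCentralSeries R L M (a + b + 1) := by
  have lie_succ (y : L) {n : M} {k : ℕ} (hn : n ∈ LieModule.lowerCentralSeries R L M k) :
      ⁅y, n⁆ ∈ LieModule.lowerCentralSeries R L M (k + 1) := by
    rw [LieModule.lowerCentralSeries_succ]
    exact LieSubmodule.lie_mem_lie (LieSubmodule.mem_top y) hn
  induction a generalizing b x m with
  | zero => simpa using lie_succ x hm
  | succ a ih =>
    rw [LieModule.lowerCentralSeries_succ, ← LieSubmodule.mem_toSubmodule,
      LieSubmodule.lieIdeal_oper_eq_linear_span] at hx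
    induction hx using Submodule.span_induction with
    | mem _ h =>
      obtain ⟨⟨y, hy⟩, ⟨z, hz⟩, rfl⟩ := h
      have h₁ := lie_succ y (ih b hz hm)
      have h₂ := ih (b + 1) hz (lie_succ y hm)
      rw [lie_lie]
      refine sub_mem ?_ ?_
      · convert h₁ using 2
        ring
      · convert h₂ using 2
        ring
    | zero => simp
    | add _ _ _ _ h₁ h₂ => simpa [add_lie] using add_mem h₁ h₂
    | smul c _ _ h => simpa [smul_lie] using SMulMemClass.smul_mem c h

/-- An iterated bracket of elements `u_t ∈ γ_{i_t}(L)` lies in `γ_{i_1 + ⋯ + i_q}(L)`. -/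
theorem iterBracket_ofFn_mem_lowerCentralSeries {R L : Type*} [CommRing R] [LieRing L]
    [LieAlgebra R L] (q : ℕ) (hq : 1 ≤ q) (idx : Fin q → ℕ) (hidx : ∀ t, 1 ≤ idx t)
    (u : Fin q → L) (hu : ∀ t, u t ∈ LieModule.lowerCentralSeries R L L (idx t - 1)) :
    iterBracket (List.ofFn u) ∈ LieModule.lowerCentralSeries R L L (∑ t, idx t - 1) := by
  induction q, hq using Nat.le_induction with
  | base => simpa [iterBracket] using hu 0
  | succ q hq ih =>
    obtain ⟨q, rfl⟩ : ∃ r, q = r + 1 := ⟨q - 1, by omega⟩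
    have hrec := ih (fun t => idx t.succ) (fun t => hidx _) (fun t => u t.succ) fun t => hu _
    have hmem := LieModule.lie_mem_lowerCentralSeries_add _ _ (hu 0) hrec
    have hpos : 1 ≤ ∑ t : Fin (q + 1), idx t.succ :=
      (hidx _).trans (Finset.single_le_sum (f := fun t : Fin (q + 1) => idx t.succ)
        (fun _ _ => Nat.zero_le _) (Finset.mem_univ 0))
    have h0 := hidx 0
    rw [Fin.sum_univ_succ, List.ofFn_succ, List.ofFn_succ, iterBracket]
    rw [List.ofFn_succ] at hmem
    convert hmem using 2
    omega

section Norm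

variable {V : Type*} [AddCommGroup V] [Module ℝ V] [FiniteDimensional ℝ V] {N : V → ℝ}

/-- Bilinear maps are bounded for any norm on a finite-dimensional real vector space. -/
theorem exists_bound_bilin (hN_nonneg : ∀ x, 0 ≤ N x) (hN_eq_zero : ∀ x, N x = 0 ↔ x = 0)
    (hN_add : ∀ x y, N (x + y) ≤ N x + N y) (hN_smul : ∀ (r : ℝ) (x : V), N (r • x) = |r| * N x)
    (f : V →ₗ[ℝ] V →ₗ[ℝ] V) : ∃ K : ℝ, 1 ≤ K ∧ ∀ x y, N (f x y) ≤ K * (N x * N y) := by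
  let _ : Norm V := ⟨N⟩
  have core : NormedSpace.Core ℝ V :=
    { norm_nonneg := hN_nonneg
      norm_smul := hN_smul
      norm_triangle := hN_add
      norm_eq_zero_iff := hN_eq_zero }
  let _ : NormedAddCommGroup V := NormedAddCommGroup.ofCore core
  let _ : NormedSpace ℝ V := NormedSpace.ofCore core
  let g : V →L[ℝ] V →L[ℝ] V := LinearMap.toContinuousLinearMap
    ((LinearMap.toContinuousLinearMap : (V →ₗ[ℝ] V) ≃ₗ[ℝ] (V →L[ℝ] V)).toLinearMap ∘ₗ f)
  refine ⟨max 1 ‖g‖, le_max_left _ _, fun x y => ?_⟩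
  calc N (f x y) ≤ ‖g‖ * N x * N y := g.le_opNorm₂ x y
    _ = ‖g‖ * (N x * N y) := mul_assoc _ _ _
    _ ≤ _ := mul_le_mul_of_nonneg_right (le_max_right _ _)
      (mul_nonneg (hN_nonneg x) (hN_nonneg y))

/-- Linear maps are bounded for any norm on a finite-dimensional real vector space. -/
theorem exists_bound_linear (hN_nonneg : ∀ x, 0 ≤ N x) (hN_eq_zero : ∀ x, N x = 0 ↔ x = 0)
    (hN_add : ∀ x y, N (x + y) ≤ N x + N y) (hN_smul : ∀ (r : ℝ) (x : V), N (r • x) = |r| * N x)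
    (f : V →ₗ[ℝ] V) : ∃ K : ℝ, 1 ≤ K ∧ ∀ x, N (f x) ≤ K * N x := by
  let _ : Norm V := ⟨N⟩
  have core : NormedSpace.Core ℝ V :=
    { norm_nonneg := hN_nonneg
      norm_smul := hN_smul
      norm_triangle := hN_add
      norm_eq_zero_iff := hN_eq_zero }
  let _ : NormedAddCommGroup V := NormedAddCommGroup.ofCore core
  let _ : NormedSpace ℝ V := NormedSpace.ofCore core
  let g : V →L[ℝ] V := LinearMap.toContinuousLinearMap f
  refine ⟨max 1 ‖g‖, le_max_left _ _, fun x => ?_⟩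
  exact (g.le_opNorm x).trans (mul_le_mul_of_nonneg_right (le_max_right _ _) (hN_nonneg x))

end Norm

theorem iterBracket_ofFn_bound {L : Type*} [LieRing L] {N : L → ℝ} (hN_nonneg : ∀ x, 0 ≤ N x)
    {K : ℝ} (hK : 1 ≤ K) (hN_lie : ∀ x y : L, N ⁅x, y⁆ ≤ K * (N x * N y))
    (q : ℕ) (hq : 1 ≤ q) (u : Fin q → L) :
    N (iterBracket (List.ofFn u)) ≤ K ^ q * ∏ t, N (u t) := by
  induction q, hq using Nat.le_induction with
  | base => simpa [iterBracket] using le_mul_of_one_le_left (hN_nonneg (u 0)) hK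
  | succ q hq ih =>
    obtain ⟨q, rfl⟩ : ∃ r, q = r + 1 := ⟨q - 1, by omega⟩
    have hrec := ih fun t => u t.succ
    rw [List.ofFn_succ] at hrec
    rw [Fin.prod_univ_succ, List.ofFn_succ, List.ofFn_succ, iterBracket]
    calc _ ≤ _ := hN_lie _ _
      _ ≤ K * (N (u 0) * (K ^ (q + 1) * ∏ t : Fin (q + 1), N (u t.succ))) := by
        have := hN_nonneg (u 0)
        gcongr
      _ = _ := by ring

section Gauge

variable {L : Type*} [LieRing L] [LieAlgebra ℝ L] {N : L → ℝ} {π : ℕ → L →ₗ[ℝ] L} {s : ℕ}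

theorem one_le_guivarchGauge (hN_nonneg : ∀ x, 0 ≤ N x) (x : L) : 1 ≤ guivarchGauge N π s x :=
  le_add_of_nonneg_right (Finset.sum_nonneg fun _ _ => Real.rpow_nonneg (hN_nonneg _) _)

theorem guivarchGauge_zero (hN_zero : N 0 = 0) : guivarchGauge N π s 0 = 1 := by
  unfold guivarchGauge
  rw [Finset.sum_eq_zero, add_zero]
  intro i hi
  have : (i : ℝ) ≠ 0 := by exact_mod_cast (Nat.one_le_iff_ne_zero.1 (Finset.mem_Icc.1 hi).1)
  rw [map_zero, hN_zero, Real.zero_rpow (by positivity)]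

theorem norm_component_le_guivarchGauge_pow (hN_nonneg : ∀ x, 0 ≤ N x) {i : ℕ} (hi : 1 ≤ i)
    (his : i ≤ s) (x : L) : N (π i x) ≤ guivarchGauge N π s x ^ i := by
  have hle : N (π i x) ^ ((1 : ℝ) / i) ≤ guivarchGauge N π s x :=
    (Finset.single_le_sum (f := fun i : ℕ => N (π i x) ^ ((1 : ℝ) / i))
      (fun _ _ => Real.rpow_nonneg (hN_nonneg _) _) (Finset.mem_Icc.2 ⟨hi, his⟩)).trans
      (le_add_of_nonneg_left zero_le_one)
  calc N (π i x) = (N (π i x) ^ ((1 : ℝ) / i)) ^ i := by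
        rw [one_div, Real.rpow_inv_natCast_pow (hN_nonneg _) (by omega)]
    _ ≤ _ := pow_le_pow_left₀ (Real.rpow_nonneg (hN_nonneg _) _) hle i

/-- If the components of `x` of index less than `d` vanish and the others have norm at most
`B ≥ 1`, then `|x|^d ≤ (1 + s)^d B`. -/
theorem guivarchGauge_pow_le (hN_nonneg : ∀ x, 0 ≤ N x) (hN_zero : N 0 = 0) {d : ℕ} (hd : 1 ≤ d)
    {x : L} {B : ℝ} (hB : 1 ≤ B) (hlow : ∀ k, 1 ≤ k → k ≤ s → k < d → π k x = 0)
    (hbound : ∀ k, 1 ≤ k → k ≤ s → N (π k x) ≤ B) :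
    guivarchGauge N π s x ^ d ≤ (1 + s) ^ d * B := by
  have hB0 : 0 ≤ B := zero_le_one.trans hB
  have hterm : ∀ k ∈ Finset.Icc 1 s, N (π k x) ^ ((1 : ℝ) / k) ≤ B ^ ((1 : ℝ) / d) := by
    intro k hk
    obtain ⟨hk1, hks⟩ := Finset.mem_Icc.1 hk
    have hk0 : (0 : ℝ) < k := by exact_mod_cast hk1
    have hd0 : (0 : ℝ) < d := by exact_mod_cast hd
    rcases lt_or_ge k d with hkd | hkd
    · rw [hlow k hk1 hks hkd, hN_zero, Real.zero_rpow (by positivity)]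
      positivity
    · calc _ ≤ B ^ ((1 : ℝ) / k) :=
            Real.rpow_le_rpow (hN_nonneg _) (hbound k hk1 hks) (by positivity)
        _ ≤ _ := Real.rpow_le_rpow_of_exponent_le hB
            (one_div_le_one_div_of_le hd0 (by exact_mod_cast hkd))
  have hsum : guivarchGauge N π s x ≤ (1 + s) * B ^ ((1 : ℝ) / d) := by
    have h₁ := Finset.sum_le_sum hterm
    rw [Finset.sum_const, Nat.card_Icc, nsmul_eq_mul, Nat.add_sub_cancel] at h₁
    have h₂ : 1 ≤ B ^ ((1 : ℝ) / d) := Real.one_le_rpow hB (by positivity)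
    unfold guivarchGauge
    linarith
  calc _ ≤ ((1 + s) * B ^ ((1 : ℝ) / d)) ^ d :=
        pow_le_pow_left₀ (zero_le_one.trans (one_le_guivarchGauge hN_nonneg x)) hsum d
    _ = _ := by rw [mul_pow, one_div, Real.rpow_inv_natCast_pow hB0 (by omega)]

end Gauge

section Components

variable {L : Type*} [LieRing L] [LieAlgebra ℝ L] {s : ℕ} {A : ℕ → Submodule ℝ L}
  {π : ℕ → L →ₗ[ℝ] L}

/-- The component `π_k x` differs from `x ∈ γ_k` by an element of `γ_{k+1}`, provided that the
components of lower index vanish. -/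
theorem sub_component_mem_lowerCentralSeries
    (hA_le : ∀ i, 1 ≤ i → ∀ x ∈ A i, x ∈ LieModule.lowerCentralSeries ℝ L L (i - 1))
    (hπ_mem : ∀ i x, π i x ∈ A i) (hπ_sum : ∀ x : L, ∑ i ∈ Finset.Icc 1 s, π i x = x)
    {k : ℕ} (hk : 1 ≤ k) (hks : k ≤ s) {x : L} (hlow : ∀ j, 1 ≤ j → j < k → π j x = 0) :
    x - π k x ∈ LieModule.lowerCentralSeries ℝ L L k := by
  have hsplit := Finset.add_sum_erase (Finset.Icc 1 s) (fun i => π i x)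
    (Finset.mem_Icc.2 ⟨hk, hks⟩)
  rw [hπ_sum] at hsplit
  rw [← eq_sub_iff_add_eq'.2 hsplit]
  refine sum_mem fun j hj => ?_
  obtain ⟨hjk, hj⟩ := Finset.mem_erase.1 hj
  have hj1 := (Finset.mem_Icc.1 hj).1
  rcases lt_or_gt_of_ne hjk with hlt | hgt
  · rw [hlow j hj1 hlt]
    exact zero_mem _
  · exact LieModule.antitone_lowerCentralSeries ℝ L L (by omega : k ≤ j - 1)
      (hA_le j hj1 _ (hπ_mem j x))

/-- The components of index less than `d` of an element of `γ_d` vanish. -/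
theorem component_eq_zero_of_mem_lowerCentralSeries
    (hA_le : ∀ i, 1 ≤ i → ∀ x ∈ A i, x ∈ LieModule.lowerCentralSeries ℝ L L (i - 1))
    (hA_disj : ∀ i, 1 ≤ i → i ≤ s →
      Disjoint (A i) (LieSubmodule.toSubmodule (LieModule.lowerCentralSeries ℝ L L i)))
    (hπ_mem : ∀ i x, π i x ∈ A i) (hπ_sum : ∀ x : L, ∑ i ∈ Finset.Icc 1 s, π i x = x)
    {d : ℕ} {x : L} (hx : x ∈ LieModule.lowerCentralSeries ℝ L L (d - 1))
    (k : ℕ) (hk : 1 ≤ k) (hks : k ≤ s) (hkd : k < d) : π k x = 0 := by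
  induction k using Nat.strong_induction_on with
  | _ k ih =>
    have hsub := sub_component_mem_lowerCentralSeries hA_le hπ_mem hπ_sum hk hks (x := x)
      fun j hj hjk => ih j hjk hj (by omega) (by omega)
    have hxk := LieModule.antitone_lowerCentralSeries ℝ L L (by omega : k ≤ d - 1) hx
    exact Submodule.disjoint_def.1 (hA_disj k hk hks) _ (hπ_mem k x)
      (by simpa using sub_mem hxk hsub)

theorem component_eq_self
    (hA_le : ∀ i, 1 ≤ i → ∀ x ∈ A i, x ∈ LieModule.lowerCentralSeries ℝ L L (i - 1))
    (hA_disj : ∀ i, 1 ≤ i → i ≤ s →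
      Disjoint (A i) (LieSubmodule.toSubmodule (LieModule.lowerCentralSeries ℝ L L i)))
    (hπ_mem : ∀ i x, π i x ∈ A i) (hπ_sum : ∀ x : L, ∑ i ∈ Finset.Icc 1 s, π i x = x)
    {i : ℕ} (hi : 1 ≤ i) (his : i ≤ s) {x : L} (hx : x ∈ A i) : π i x = x := by
  have hsub := sub_component_mem_lowerCentralSeries hA_le hπ_mem hπ_sum hi his (x := x)
    fun j hj hji => component_eq_zero_of_mem_lowerCentralSeries hA_le hA_disj hπ_mem hπ_sum
      (hA_le i hi x hx) j hj (by omega) hji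
  exact (sub_eq_zero.1 (Submodule.disjoint_def.1 (hA_disj i hi his) _
    (sub_mem hx (hπ_mem i x)) hsub)).symm

end Components

/-- In a finite-dimensional real nilpotent Lie algebra `𝔤` with `γ_{s+1}(𝔤) = 0`,
fixed complements `A_i` of `γ_{i+1}(𝔤)` inside `γ_i(𝔤)` (with the convention `A_i = 0` for
`i > s`) and the associated Guivarc'h gauge, there is `C ≥ 1` such that for all `q ≥ 1`,
indices `i_1, …, i_q ≥ 1` and elements `u_ℓ ∈ A_{i_ℓ}`,
`|[u_1, …, u_q]|^{i_1+⋯+i_q} ≤ C·|u_1|^{i_1}⋯|u_q|^{i_q}`.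
Here `γ_i(𝔤)` is `LieModule.lowerCentralSeries ℝ 𝔤 𝔤 (i-1)`. -/
theorem guivarch_gauge_iterated_bracket_bound
    {L : Type*} [LieRing L] [LieAlgebra ℝ L] [FiniteDimensional ℝ L]
    (s : ℕ) (hs : 1 ≤ s)
    (hnil : LieModule.lowerCentralSeries ℝ L L s = ⊥)
    (A : ℕ → Submodule ℝ L)
    (hA_sup : ∀ i, 1 ≤ i → i ≤ s →
      A i ⊔ LieSubmodule.toSubmodule (LieModule.lowerCentralSeries ℝ L L i)
        = LieSubmodule.toSubmodule (LieModule.lowerCentralSeries ℝ L L (i - 1)))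
    (hA_disj : ∀ i, 1 ≤ i → i ≤ s →
      Disjoint (A i) (LieSubmodule.toSubmodule (LieModule.lowerCentralSeries ℝ L L i)))
    (hA_top : ∀ i, s < i → A i = ⊥)
    (N : L → ℝ)
    (hN_nonneg : ∀ x, 0 ≤ N x)
    (hN_eq_zero : ∀ x, N x = 0 ↔ x = 0)
    (hN_add : ∀ x y, N (x + y) ≤ N x + N y)
    (hN_smul : ∀ (r : ℝ) (x : L), N (r • x) = |r| * N x)
    (π : ℕ → L →ₗ[ℝ] L)
    (hπ_mem : ∀ i x, π i x ∈ A i)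
    (hπ_sum : ∀ x : L, ∑ i ∈ Finset.Icc 1 s, π i x = x) :
    ∃ C : ℝ, 1 ≤ C ∧ ∀ q : ℕ, 1 ≤ q → ∀ idx : Fin q → ℕ, (∀ t, 1 ≤ idx t) →
      ∀ u : Fin q → L, (∀ t, u t ∈ A (idx t)) →
        guivarchGauge N π s (iterBracket (List.ofFn u)) ^ (∑ t, idx t)
          ≤ C * ∏ t, guivarchGauge N π s (u t) ^ idx t := by
  have hN_zero : N 0 = 0 := (hN_eq_zero 0).2 rfl
  have hA_le : ∀ i, 1 ≤ i → ∀ x ∈ A i, x ∈ LieModule.lowerCentralSeries ℝ L L (i - 1) := by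
    intro i hi x hx
    rcases le_or_gt i s with his | his
    · rw [← LieSubmodule.mem_toSubmodule, ← hA_sup i hi his]
      exact Submodule.mem_sup_left hx
    · rw [hA_top i his, Submodule.mem_bot] at hx
      exact hx ▸ zero_mem _
  obtain ⟨K, hK, hN_lie⟩ := exists_bound_bilin hN_nonneg hN_eq_zero hN_add hN_smul
    (LieModule.toEnd ℝ L L : L →ₗ[ℝ] Module.End ℝ L)
  choose c hc hN_π using fun k =>
    exists_bound_linear hN_nonneg hN_eq_zero hN_add hN_smul (π k)
  obtain ⟨c', hc'⟩ := ((Finset.Icc 1 s).image c).exists_le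
  set P : ℝ := max 1 c'
  have hP1 : 1 ≤ P := le_max_left _ _
  have hcP : ∀ k, 1 ≤ k → k ≤ s → c k ≤ P := fun k hk hks =>
    (hc' _ (Finset.mem_image_of_mem c (Finset.mem_Icc.2 ⟨hk, hks⟩))).trans (le_max_right _ _)
  have hs1 : (1 : ℝ) ≤ 1 + s := le_add_of_nonneg_right (Nat.cast_nonneg s)
  have hC : 1 ≤ (1 + s : ℝ) ^ s * (P * K ^ s) :=
    one_le_mul_of_one_le_of_one_le (one_le_pow₀ hs1)
      (one_le_mul_of_one_le_of_one_le hP1 (one_le_pow₀ hK))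
  refine ⟨(1 + s : ℝ) ^ s * (P * K ^ s), hC, fun q hq idx hidx u hu => ?_⟩
  set w := iterBracket (List.ofFn u)
  set d := ∑ t, idx t
  have hprod : 1 ≤ ∏ t, guivarchGauge N π s (u t) ^ idx t :=
    Finset.one_le_prod fun t _ => one_le_pow₀ (one_le_guivarchGauge hN_nonneg _)
  have hw : w ∈ LieModule.lowerCentralSeries ℝ L L (d - 1) :=
    iterBracket_ofFn_mem_lowerCentralSeries q hq idx hidx u fun t => hA_le _ (hidx t) _ (hu t)
  have hqd : q ≤ d := by
    simpa using Finset.sum_le_sum fun t (_ : t ∈ Finset.univ) => hidx t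
  rcases lt_or_ge s d with hsd | hds
  · have hw0 : w = 0 := by
      have := LieModule.antitone_lowerCentralSeries ℝ L L (by omega : s ≤ d - 1) hw
      rwa [hnil, LieSubmodule.mem_bot] at this
    rw [hw0, guivarchGauge_zero hN_zero, one_pow]
    exact one_le_mul_of_one_le_of_one_le hC hprod
  · have hu_le : ∀ t, N (u t) ≤ guivarchGauge N π s (u t) ^ idx t := by
      intro t
      have hts : idx t ≤ s :=
        (Finset.single_le_sum (fun _ _ => Nat.zero_le _) (Finset.mem_univ t)).trans hds
      simpa only [component_eq_self hA_le hA_disj hπ_mem hπ_sum (hidx t) hts (hu t)] using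
        norm_component_le_guivarchGauge_pow (π := π) hN_nonneg (hidx t) hts (u t)
    have hNw : N w ≤ K ^ s * ∏ t, guivarchGauge N π s (u t) ^ idx t :=
      calc N w ≤ K ^ q * ∏ t, N (u t) := iterBracket_ofFn_bound hN_nonneg hK hN_lie q hq u
        _ ≤ _ := mul_le_mul (pow_le_pow_right₀ hK (hqd.trans hds))
          (Finset.prod_le_prod (fun t _ => hN_nonneg _) fun t _ => hu_le t)
          (Finset.prod_nonneg fun t _ => hN_nonneg _) (by positivity)
    have hKw := one_le_mul_of_one_le_of_one_le (one_le_pow₀ hK : 1 ≤ K ^ s) hprod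
    have hgauge := guivarchGauge_pow_le hN_nonneg hN_zero (hq.trans hqd)
      (one_le_mul_of_one_le_of_one_le hP1 hKw)
      (component_eq_zero_of_mem_lowerCentralSeries hA_le hA_disj hπ_mem hπ_sum hw)
      (fun k hk hks => (hN_π k w).trans
        (mul_le_mul (hcP k hk hks) hNw (hN_nonneg w) (zero_le_one.trans hP1)))
    calc _ ≤ _ := hgauge
      _ ≤ (1 + s : ℝ) ^ s * (P * (K ^ s * ∏ t, guivarchGauge N π s (u t) ^ idx t)) :=
        mul_le_mul_of_nonneg_right (pow_le_pow_right₀ hs1 hds) (by positivity)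
      _ = _ := by ring
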